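/- Let G be a nonempty open connected proper subset of ℝ² whose boundary contains a nondegenerate line segment [u,v] (with u ≠ v). Then there exist distinct points x, y ∈ G such that p_G(x,y) = √2·j*_G(x,y). -/

import Mathlib

open Set Metric

/-- Distance from `x` to the boundary of `G`. -/
noncomputable def distBd (G : Set (EuclideanSpace ℝ (Fin 2)))
    (x : EuclideanSpace ℝ (Fin 2)) : ℝ :=
  Metric.infDist x (frontier G)

/-- The `j*`-metric. -/
noncomputable def jStar (G : Set (EuclideanSpace ℝ (Fin 2)))
    (x y : EuclideanSpace ℝ (Fin 2)) : ℝ :=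
  dist x y / (dist x y + 2 * min (distBd G x) (distBd G y))

/-- The point pair function `p_G`. -/
noncomputable def pointPair (G : Set (EuclideanSpace ℝ (Fin 2)))
    (x y : EuclideanSpace ℝ (Fin 2)) : ℝ :=
  dist x y / Real.sqrt (dist x y ^ 2 + 4 * distBd G x * distBd G y)

open Filter Topology

/-- A preconnected set that meets an open set but not its frontier is contained in it. -/
theorem IsPreconnected.subset_of_disjoint_frontier {X : Type*} [TopologicalSpace X] {s t : Set X}
    (hs : IsPreconnected s) (ht : IsOpen t) (hst : (s ∩ t).Nonempty)
    (hdisj : Disjoint s (frontier t)) : s ⊆ t := by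
  refine hs.subset_of_closure_inter_subset ht hst fun x hx => ?_
  by_contra hxt
  exact disjoint_left.1 hdisj hx.2 (ht.frontier_eq ▸ ⟨hx.1, hxt⟩)

theorem infDist_frontier_pos {X : Type*} [PseudoMetricSpace X] {G : Set X} (hopen : IsOpen G)
    (hfr : (frontier G).Nonempty) {x : X} (hx : x ∈ G) : 0 < infDist x (frontier G) := by
  refine (isClosed_frontier.notMem_iff_infDist_pos hfr).1 fun h => ?_
  rw [hopen.frontier_eq] at h
  exact h.2 hx

section Proximity

variable {E : Type*} [NormedAddCommGroup E] [InnerProductSpace ℝ E]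

/-- Moving from a point straight away from its unique nearest point in a closed set increases the
distance to that set at a rate arbitrarily close to one. -/
theorem exists_lt_infDist_of_unique_nearest [ProperSpace E] {K : Set E} (hK : IsClosed K) {y z : E}
    (hz : z ∈ K) (hyz : dist y z = infDist y K)
    (huniq : ∀ f ∈ K, dist y f = infDist y K → f = z) (hd : 0 < infDist y K)
    {l δ : ℝ} (hl : l < 1) (hδ : 0 < δ) :
    ∃ y' ∈ ball y δ, infDist y K + l * dist y' y < infDist y' K := by
  by_contra! hcon
  set d := infDist y K with hd_def
  have hnorm : ‖y - z‖ = d := by rw [← dist_eq_norm, hyz]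
  let t : ℕ → ℝ := fun k => δ / (2 * d) * (1 / ((k : ℝ) + 1))
  have ht0 : ∀ k, 0 < t k := fun k => by positivity
  have ht : Tendsto t atTop (𝓝 0) := by
    simpa [t] using tendsto_one_div_add_atTop_nhds_zero_nat.const_mul (δ / (2 * d))
  have htd : ∀ k, t k * d < δ := by
    intro k
    have h1 : t k * d = δ / 2 * (1 / ((k : ℝ) + 1)) := by
      simp only [t]; field_simp
    have h2 : 1 / ((k : ℝ) + 1) ≤ 1 := by
      rw [div_le_one (by positivity)]; linarith [(Nat.cast_nonneg k : (0 : ℝ) ≤ k)]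
    rw [h1]; nlinarith
  have hdist : ∀ k, dist (y + t k • (y - z)) y = t k * d := by
    intro k
    rw [dist_eq_norm, add_sub_cancel_left, norm_smul, hnorm, Real.norm_of_nonneg (ht0 k).le]
  have hex : ∀ k, ∃ f ∈ K, dist (y + t k • (y - z)) f ≤ d + l * (t k * d) := by
    intro k
    obtain ⟨f, hf, hfd⟩ := hK.exists_infDist_eq_dist ⟨z, hz⟩ (y + t k • (y - z))
    refine ⟨f, hf, ?_⟩
    have := hcon (y + t k • (y - z)) (by rw [mem_ball, hdist]; exact htd k)
    rwa [hdist, hfd] at this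
  choose f hfK hf using hex
  have hfy : ∀ k, dist (f k) y ≤ d + (l + 1) * (t k * d) := by
    intro k
    have := dist_triangle_left (f k) y (y + t k • (y - z))
    rw [hdist] at this
    linarith [hf k]
  have hlim : Tendsto (fun k => d + (l + 1) * (t k * d)) atTop (𝓝 d) := by
    simpa using ((ht.mul_const d).const_mul (l + 1)).const_add d
  have hbdd : Bornology.IsBounded (range f) := by
    obtain ⟨C, hC⟩ := hlim.bddAbove_range
    refine isBounded_closedBall.subset (?_ : range f ⊆ closedBall y C)
    rintro _ ⟨k, rfl⟩
    exact (hfy k).trans (hC ⟨k, rfl⟩)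
  obtain ⟨a, -, φ, hφ, ha⟩ := tendsto_subseq_of_bounded hbdd (fun k => mem_range_self k)
  have haK : a ∈ K := hK.mem_of_tendsto ha (Eventually.of_forall fun k => hfK _)
  have had : dist a y ≤ d := le_of_tendsto_of_tendsto' (ha.dist tendsto_const_nhds)
    (hlim.comp hφ.tendsto_atTop) (fun k => hfy _)
  have haz : a = z := huniq a haK
    (le_antisymm (by rwa [dist_comm]) (infDist_le_dist_of_mem haK))
  subst haz
  have key : ∀ k, 2 * inner ℝ (y - f k) (y - a) + t k * d ^ 2
      ≤ 2 * l * d ^ 2 + l ^ 2 * t k * d ^ 2 := by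
    intro k
    have h1 : ‖(y - f k) + t k • (y - a)‖ ≤ d + l * (t k * d) := by
      have := hf k
      rwa [dist_eq_norm, add_sub_right_comm] at this
    have h2 : d ≤ ‖y - f k‖ := by
      rw [← dist_eq_norm]; exact infDist_le_dist_of_mem (hfK k)
    have h3 := norm_add_sq_real (y - f k) (t k • (y - a))
    rw [inner_smul_right, norm_smul, hnorm, Real.norm_of_nonneg (ht0 k).le] at h3
    have h4 := pow_le_pow_left₀ (norm_nonneg _) h1 2
    have h5 := pow_le_pow_left₀ hd.le h2 2
    refine le_of_mul_le_mul_left ?_ (ht0 k)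
    nlinarith
  have hlim1 : Tendsto (fun k => 2 * inner ℝ (y - f (φ k)) (y - a) + t (φ k) * d ^ 2) atTop
      (𝓝 (2 * inner ℝ (y - a) (y - a) + 0 * d ^ 2)) :=
    (((tendsto_const_nhds.sub ha).inner tendsto_const_nhds).const_mul 2).add
      ((ht.comp hφ.tendsto_atTop).mul_const _)
  have hlim2 : Tendsto (fun k => 2 * l * d ^ 2 + l ^ 2 * t (φ k) * d ^ 2) atTop
      (𝓝 (2 * l * d ^ 2 + l ^ 2 * 0 * d ^ 2)) :=
    (((ht.comp hφ.tendsto_atTop).const_mul (l ^ 2)).mul_const _).const_add _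
  have := le_of_tendsto_of_tendsto' hlim1 hlim2 (fun k => key _)
  rw [real_inner_self_eq_norm_sq, hnorm] at this
  nlinarith [pow_pos hd 2]

/-- On the segment from a nearest point to `x`, the distance to the set grows linearly. -/
theorem infDist_lineMap_of_nearest {K : Set E} {x z : E} (hz : z ∈ K)
    (hxz : dist x z = infDist x K) {t : ℝ} (ht0 : 0 ≤ t) (ht1 : t ≤ 1) :
    infDist (AffineMap.lineMap z x t) K = t * infDist x K := by
  apply le_antisymm
  · refine (infDist_le_dist_of_mem hz).trans_eq ?_
    rw [dist_lineMap_left, Real.norm_of_nonneg ht0, dist_comm, hxz]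
  · have h := infDist_le_infDist_add_dist (s := K) (x := x) (y := AffineMap.lineMap z x t)
    rw [dist_right_lineMap, Real.norm_of_nonneg (by linarith), dist_comm z x, hxz] at h
    linarith

variable {G : Set E}

/-- A ball meeting `G`, of radius the distance of its centre to the boundary, is contained
in `G`. -/
theorem ball_infDist_frontier_subset (hopen : IsOpen G) {x : E}
    (hx : (ball x (infDist x (frontier G)) ∩ G).Nonempty) :
    ball x (infDist x (frontier G)) ⊆ G :=
  (convex_ball x _).isPreconnected.subset_of_disjoint_frontier hopen hx disjoint_ball_infDist

/-- If all nearest boundary points are unique, every point of `G` lies in arbitrarily large balls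
contained in `G`. -/
theorem exists_large_ball_of_unique_nearest [ProperSpace E] (hopen : IsOpen G)
    (hfr : (frontier G).Nonempty)
    (huniq : ∀ x ∈ G, ∀ z₁ ∈ frontier G, ∀ z₂ ∈ frontier G,
      dist x z₁ = infDist x (frontier G) → dist x z₂ = infDist x (frontier G) → z₁ = z₂)
    {x : E} (hx : x ∈ G) {N : ℝ} (hN : infDist x (frontier G) ≤ N) :
    ∃ y ∈ G, dist y x = N ∧ N < infDist y (frontier G) := by
  set K := frontier G
  have hd0 : 0 < infDist x K := infDist_frontier_pos hopen hfr hx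
  have hN0 : 0 < N := hd0.trans_le hN
  obtain ⟨l, hlN⟩ : ∃ l : ℝ, (1 - l) * N = infDist x K / 2 :=
    ⟨1 - infDist x K / (2 * N), by field_simp; ring⟩
  have hl1 : l < 1 := by
    by_contra! h
    nlinarith
  have hl0 : 0 ≤ l := by
    by_contra! h
    nlinarith
  have hcont : Continuous fun y => infDist y K - l * dist y x :=
    (continuous_infDist_pt K).sub (continuous_const.mul (continuous_id.dist continuous_const))
  obtain ⟨y, hyN, hmax⟩ := (isCompact_closedBall x N).exists_isMaxOn
    ⟨x, mem_closedBall_self hN0.le⟩ hcont.continuousOn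
  rw [mem_closedBall] at hyN
  have hyx : dist y x < infDist y K := by
    have : infDist x K - l * dist x x ≤ infDist y K - l * dist y x :=
      hmax (mem_closedBall_self hN0.le)
    rw [dist_self] at this
    nlinarith
  have hyG : y ∈ G := ball_infDist_frontier_subset hopen
    ⟨x, by rwa [mem_ball, dist_comm], hx⟩ (mem_ball_self (dist_nonneg.trans_lt hyx))
  rcases hyN.eq_or_lt with h | h
  · exact ⟨y, hyG, h, h ▸ hyx⟩
  · exfalso
    obtain ⟨z, hz, hzd⟩ := isClosed_frontier.exists_infDist_eq_dist hfr y
    obtain ⟨y', hy', hlt⟩ := exists_lt_infDist_of_unique_nearest isClosed_frontier hz hzd.symm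
      (fun f hf hfd => huniq y hyG f hf z hz hfd hzd.symm) (dist_nonneg.trans_lt hyx) hl1
      (sub_pos.2 h)
    rw [mem_ball] at hy'
    have htri := dist_triangle y' y x
    have : infDist y' K - l * dist y' x ≤ infDist y K - l * dist y x :=
      hmax (by rw [mem_closedBall]; linarith)
    nlinarith [mul_le_mul_of_nonneg_left htri hl0]

/-- If all nearest boundary points are unique, then through every boundary point passes a
hyperplane one open side of which is contained in `G`. -/
theorem exists_halfSpace_subset_of_unique_nearest [ProperSpace E] (hopen : IsOpen G)
    (huniq : ∀ x ∈ G, ∀ z₁ ∈ frontier G, ∀ z₂ ∈ frontier G,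
      dist x z₁ = infDist x (frontier G) → dist x z₂ = infDist x (frontier G) → z₁ = z₂)
    {m : E} (hm : m ∈ frontier G) :
    ∃ n : E, ‖n‖ = 1 ∧ (∀ f ∈ frontier G, inner ℝ (f - m) n ≤ 0) ∧
      ∀ p, 0 < inner ℝ (p - m) n → p ∈ G := by
  have hex : ∀ k : ℕ, ∃ x ∈ G, dist m x < 1 / ((k : ℝ) + 1) := fun k =>
    Metric.mem_closure_iff.1 (frontier_subset_closure hm) _ (by positivity)
  choose x hxG hxm using hex
  have hex : ∀ k : ℕ, ∃ y ∈ G, dist y (x k) = (k : ℝ) + 1 ∧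
      (k : ℝ) + 1 < infDist y (frontier G) := by
    intro k
    refine exists_large_ball_of_unique_nearest hopen ⟨m, hm⟩ huniq (hxG k) ?_
    have h1 : infDist (x k) (frontier G) ≤ dist (x k) m := infDist_le_dist_of_mem hm
    have h2 : 1 / ((k : ℝ) + 1) ≤ 1 := by
      rw [div_le_one (by positivity)]; linarith [(Nat.cast_nonneg k : (0 : ℝ) ≤ k)]
    rw [dist_comm] at h1
    linarith [hxm k, (Nat.cast_nonneg k : (0 : ℝ) ≤ k)]
  choose y hyG hyx hyd using hex
  have hx : Tendsto x atTop (𝓝 m) := by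
    rw [tendsto_iff_dist_tendsto_zero]
    refine squeeze_zero (fun _ => dist_nonneg) (fun k => ?_)
      (tendsto_one_div_add_atTop_nhds_zero_nat (𝕜 := ℝ))
    rw [dist_comm]; exact (hxm k).le
  let e : ℕ → E := fun k => (1 / ((k : ℝ) + 1)) • (y k - x k)
  have he : ∀ k, ‖e k‖ = 1 := by
    intro k
    have h0 : (0 : ℝ) < (k : ℝ) + 1 := by positivity
    simp only [e]
    rw [norm_smul, ← dist_eq_norm, hyx, Real.norm_of_nonneg (by positivity)]
    field_simp
  have hye : ∀ k, y k - x k = ((k : ℝ) + 1) • e k := by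
    intro k
    have h0 : (k : ℝ) + 1 ≠ 0 := by positivity
    simp only [e]
    rw [smul_smul, mul_one_div_cancel h0, one_smul]
  obtain ⟨n, hn, φ, hφ, hlim⟩ := (isCompact_sphere (0 : E) 1).tendsto_subseq
    (x := e) (fun k => by simp [he k])
  have hn1 : ‖n‖ = 1 := by simpa using hn
  have hxφ := hx.comp hφ.tendsto_atTop
  have hside : ∀ f ∈ frontier G, inner ℝ (f - m) n ≤ 0 := by
    intro f hf
    have key : ∀ k, inner ℝ (f - x k) (e k) ≤ ‖f - x k‖ ^ 2 * (1 / ((k : ℝ) + 1)) := by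
      intro k
      have h0 : (0 : ℝ) < (k : ℝ) + 1 := by positivity
      have h1 : (k : ℝ) + 1 ≤ ‖(f - x k) - (y k - x k)‖ := by
        rw [sub_sub_sub_cancel_right, ← dist_eq_norm, dist_comm]
        exact (hyd k).le.trans (infDist_le_dist_of_mem hf)
      have h2 := norm_sub_sq_real (f - x k) (y k - x k)
      rw [← dist_eq_norm (y k), hyx, hye k, inner_smul_right, ← hye k] at h2
      have h3 := pow_le_pow_left₀ h0.le h1 2
      rw [mul_one_div, le_div_iff₀ h0]
      nlinarith [sq_nonneg ‖f - x k‖]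
    have hl1 : Tendsto (fun k => inner ℝ (f - x (φ k)) (e (φ k))) atTop
        (𝓝 (inner ℝ (f - m) n)) := (tendsto_const_nhds.sub hxφ).inner hlim
    have hl2 : Tendsto (fun k => ‖f - x (φ k)‖ ^ 2 * (1 / (((φ k : ℕ) : ℝ) + 1))) atTop
        (𝓝 (‖f - m‖ ^ 2 * 0)) :=
      ((tendsto_const_nhds.sub hxφ).norm.pow 2).mul
        ((tendsto_one_div_add_atTop_nhds_zero_nat (𝕜 := ℝ)).comp hφ.tendsto_atTop)
    simpa using le_of_tendsto_of_tendsto' hl1 hl2 (fun k => key _)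
  refine ⟨n, hn1, hside, fun p hp => ?_⟩
  have hl1 : Tendsto (fun k => inner ℝ (x (φ k) - m) n) atTop (𝓝 (inner ℝ (m - m) n)) :=
    (hxφ.sub tendsto_const_nhds).inner tendsto_const_nhds
  have hl2 : Tendsto (fun k => inner ℝ (e (φ k)) n) atTop (𝓝 (inner ℝ n n)) :=
    hlim.inner tendsto_const_nhds
  rw [sub_self, inner_zero_left] at hl1
  rw [real_inner_self_eq_norm_sq, hn1, one_pow] at hl2
  obtain ⟨k, hk1, hk2⟩ := ((hl1.eventually_const_lt (show (-1 / 2 : ℝ) < 0 by norm_num)).and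
    (hl2.eventually_const_lt (show (1 / 2 : ℝ) < 1 by norm_num))).exists
  have hyk : 0 < inner ℝ (y (φ k) - m) n := by
    rw [← sub_add_sub_cancel (y (φ k)) (x (φ k)) m, inner_add_left, hye, real_inner_smul_left]
    nlinarith [(Nat.cast_nonneg (φ k) : (0 : ℝ) ≤ φ k)]
  have hconv : Convex ℝ {q : E | 0 < inner ℝ (q - m) n} := by
    have : {q : E | 0 < inner ℝ (q - m) n} = {q : E | inner ℝ m n < innerₛₗ ℝ n q} := by
      ext q
      simp [inner_sub_left, real_inner_comm]
    rw [this]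
    exact convex_halfSpace_gt (innerₛₗ ℝ n).isLinear _
  exact hconv.isPreconnected.subset_of_disjoint_frontier hopen ⟨y (φ k), hyk, hyG _⟩
    (disjoint_left.2 fun w hw hwf => (hside w hwf).not_gt hw) hp

end Proximity

/-- Equality `p_G = √2 j*_G` holds for points at equal distance `r` from the boundary and at
distance `2r` from each other. -/
theorem pointPair_eq_sqrt_two_mul_jStar {G : Set (EuclideanSpace ℝ (Fin 2))}
    {x y : EuclideanSpace ℝ (Fin 2)} {r : ℝ} (hr : 0 < r)
    (hx : infDist x (frontier G) = r) (hy : infDist y (frontier G) = r) (hxy : dist x y = 2 * r) :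
    pointPair G x y = Real.sqrt 2 * jStar G x y := by
  have hsq : Real.sqrt ((2 * r) ^ 2 + 4 * r * r) = Real.sqrt 2 * (2 * r) := by
    rw [show (2 * r) ^ 2 + 4 * r * r = 2 * (2 * r) ^ 2 by ring, Real.sqrt_mul (by norm_num),
      Real.sqrt_sq (by positivity)]
  have h2 : Real.sqrt 2 ^ 2 = 2 := Real.sq_sqrt (by norm_num)
  rw [pointPair, jStar, distBd, distBd, hx, hy, hxy, min_self, hsq]
  field_simp
  linarith

theorem stmt_3 (G : Set (EuclideanSpace ℝ (Fin 2)))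
    (hne : G.Nonempty) (hopen : IsOpen G) (hconn : IsConnected G) (hproper : G ≠ univ)
    (u v : EuclideanSpace ℝ (Fin 2)) (huv : u ≠ v)
    (hseg : segment ℝ u v ⊆ frontier G) :
    ∃ x ∈ G, ∃ y ∈ G, x ≠ y ∧ pointPair G x y = Real.sqrt 2 * jStar G x y := by
  have hm : midpoint ℝ u v ∈ frontier G := hseg (midpoint_mem_segment u v)
  have hfr : (frontier G).Nonempty := ⟨_, hm⟩
  by_cases huniq : ∀ x ∈ G, ∀ z₁ ∈ frontier G, ∀ z₂ ∈ frontier G,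
      dist x z₁ = infDist x (frontier G) → dist x z₂ = infDist x (frontier G) → z₁ = z₂
  · obtain ⟨n, hn, hside, hG⟩ := exists_halfSpace_subset_of_unique_nearest hopen huniq hm
    have hsum : (u - midpoint ℝ u v) + (v - midpoint ℝ u v) = 0 := by
      rw [left_sub_midpoint, right_sub_midpoint, ← smul_add]
      simp
    have hsum' : inner ℝ (u - midpoint ℝ u v) n + inner ℝ (v - midpoint ℝ u v) n = 0 := by
      rw [← inner_add_left, hsum, inner_zero_left]
    have huf : u ∈ frontier G := hseg (left_mem_segment ℝ u v)
    have hvf : v ∈ frontier G := hseg (right_mem_segment ℝ u v)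
    have hu := hside u huf
    have hv := hside v hvf
    have hr : 0 < dist u v / 2 := half_pos (dist_pos.2 huv)
    set r := dist u v / 2 with hr_def
    have hnn : inner ℝ n n = (1 : ℝ) := by rw [real_inner_self_eq_norm_sq, hn, one_pow]
    have hshift : ∀ w ∈ frontier G, inner ℝ (w - midpoint ℝ u v) n = 0 →
        w + r • n ∈ G ∧ infDist (w + r • n) (frontier G) = r := by
      intro w hw hw0
      have hin : inner ℝ (w + r • n - midpoint ℝ u v) n = r := by
        rw [add_sub_right_comm, inner_add_left, hw0, real_inner_smul_left, hnn]
        ring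
      refine ⟨hG _ (by rw [hin]; exact hr), le_antisymm ?_ ((le_infDist hfr).2 fun f hf => ?_)⟩
      · refine (infDist_le_dist_of_mem hw).trans_eq ?_
        rw [dist_eq_norm, add_sub_cancel_left, norm_smul, hn, Real.norm_of_nonneg hr.le, mul_one]
      · have h1 := real_inner_le_norm (w + r • n - f) n
        rw [← sub_sub_sub_cancel_right _ f (midpoint ℝ u v), inner_sub_left, hin,
          sub_sub_sub_cancel_right, hn, mul_one, ← dist_eq_norm] at h1
        linarith [hside f hf]
    obtain ⟨huG, hud⟩ := hshift u huf (by linarith)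
    obtain ⟨hvG, hvd⟩ := hshift v hvf (by linarith)
    refine ⟨u + r • n, huG, v + r • n, hvG, fun h => huv (add_right_cancel h),
      pointPair_eq_sqrt_two_mul_jStar hr hud hvd ?_⟩
    rw [dist_add_right, hr_def]
    ring
  · push Not at huniq
    obtain ⟨x, hx, z₁, hz₁, z₂, hz₂, h₁, h₂, hne⟩ := huniq
    have hd : 0 < infDist x (frontier G) := infDist_frontier_pos hopen hfr hx
    have hL : 0 < dist z₁ z₂ := dist_pos.2 hne
    set d := infDist x (frontier G) with hd_def
    set L := dist z₁ z₂ with hL_def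
    obtain ⟨t, ht⟩ : ∃ t, t = L / (L + 2 * d) := ⟨_, rfl⟩
    have ht0 : 0 < t := by rw [ht]; positivity
    have ht1 : t < 1 := by rw [ht, div_lt_one (by positivity)]; linarith
    have hmem : ∀ z, dist x z = d → AffineMap.lineMap z x t ∈ G := by
      intro z hz
      refine ball_infDist_frontier_subset hopen ⟨x, mem_ball_self hd, hx⟩ ?_
      rw [mem_ball, dist_lineMap_right, Real.norm_of_nonneg (by linarith), dist_comm, hz,
        ← hd_def]
      nlinarith
    have hdist : dist (AffineMap.lineMap z₁ x t) (AffineMap.lineMap z₂ x t) = 2 * (t * d) := by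
      have h : AffineMap.lineMap z₁ x t - AffineMap.lineMap z₂ x t = (1 - t) • (z₁ - z₂) := by
        simp only [AffineMap.lineMap_apply_module]
        module
      rw [dist_eq_norm, h, norm_smul, Real.norm_of_nonneg (by linarith), ← dist_eq_norm,
        ← hL_def, ht]
      field_simp
      ring
    have htd : 0 < t * d := mul_pos ht0 hd
    exact ⟨_, hmem z₁ h₁, _, hmem z₂ h₂, dist_pos.1 (by rw [hdist]; linarith),
      pointPair_eq_sqrt_two_mul_jStar htd
        (infDist_lineMap_of_nearest hz₁ h₁ ht0.le ht1.le)
        (infDist_lineMap_of_nearest hz₂ h₂ ht0.le ht1.le) hdist⟩
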